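/- arXiv:2006.02077 — 2 statements merged into one kernel-verified Lean document; each statement's English description precedes it below -/
import Mathlib

section
/- Let K ⊂ ℝ^d be a compact set, θ₀ a point in the interior of K, and f : K → ℝ a continuous function with a unique global minimizer at θ₀, i.e., f(θ) > f(θ₀) for all θ ∈ K with θ ≠ θ₀. Let f_n : K → ℝ be continuous functions with sup_{θ∈K} |f_n(θ) − f(θ)| → 0 as n → ∞. Assume moreover that there are δ > 0 with the closed ball B̄(θ₀, δ) ⊆ K, a constant C > 0, and N₀ ∈ ℕ such that for every n ≥ N₀ the function f_n is twice continuously differentiable on B̄(θ₀, δ) with gᵀ ∇²f_n(θ) g ≥ C ‖g‖² for all θ ∈ B̄(θ₀, δ) and all g ∈ ℝ^d. Then there exists N ∈ ℕ such that for every n ≥ N the function f_n attains its global minimum over K at a unique point, and this minimizer lies in B̄(θ₀, δ). -/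
open Metric

/-- A `C²` function with positive definite Hessian on an open convex set has at most one critical
point there. -/
theorem eq_of_fderiv_eq_zero_of_hessian_pos {E : Type*} [NormedAddCommGroup E] [NormedSpace ℝ E]
    {U : Set E} (hU : IsOpen U) (hconv : Convex ℝ U) {g : E → ℝ} (hg : ContDiffOn ℝ 2 g U)
    (hpos : ∀ z ∈ U, ∀ v : E, v ≠ 0 → 0 < fderiv ℝ (fderiv ℝ g) z v v)
    {x y : E} (hx : x ∈ U) (hy : y ∈ U) (hx' : fderiv ℝ g x = 0) (hy' : fderiv ℝ g y = 0) :
    x = y := by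
  by_contra hxy
  have hmem : ∀ t ∈ Set.Icc (0 : ℝ) 1, x + t • (y - x) ∈ U := fun t ht =>
    hconv.add_smul_sub_mem hx hy ht
  have hdiff : ∀ z ∈ U, DifferentiableAt ℝ (fderiv ℝ g) z := fun z hz =>
    ((hg.fderiv_of_isOpen hU (m := 1) (by norm_num)).contDiffAt
      (hU.mem_nhds hz)).differentiableAt (by norm_num)
  have hderiv : ∀ t ∈ Set.Icc (0 : ℝ) 1,
      HasDerivAt (fun s : ℝ => fderiv ℝ g (x + s • (y - x)) (y - x))
        (fderiv ℝ (fderiv ℝ g) (x + t • (y - x)) (y - x) (y - x)) t := by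
    intro t ht
    have hline : HasDerivAt (fun s : ℝ => x + s • (y - x)) (y - x) t := by
      simpa using ((hasDerivAt_id t).smul_const (y - x)).const_add x
    have hcomp := (hdiff _ (hmem t ht)).hasFDerivAt.comp_hasDerivAt t hline
    simpa using hcomp.clm_apply (hasDerivAt_const t (y - x))
  obtain ⟨t, ht, h0⟩ := exists_hasDerivAt_eq_zero (zero_lt_one' ℝ)
    (fun t ht => (hderiv t ht).continuousAt.continuousWithinAt) (by simp [hx', hy'])
    (fun t ht => hderiv t (Set.Ioo_subset_Icc_self ht))
  exact (hpos _ (hmem t (Set.Ioo_subset_Icc_self ht)) _ (sub_ne_zero.2 (Ne.symm hxy))).ne' h0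

/-- A strict minimum over a compact set is separated by a positive gap from the values outside a
ball around the minimizer. -/
theorem exists_pos_forall_add_le_of_isCompact {X : Type*} [PseudoMetricSpace X] {K : Set X}
    (hK : IsCompact K) {f : X → ℝ} (hf : ContinuousOn f K) {x₀ : X}
    (hmin : ∀ x ∈ K, x ≠ x₀ → f x₀ < f x) {δ : ℝ} (hδ : 0 < δ) :
    ∃ ε > 0, ∀ x ∈ K, x ∉ ball x₀ δ → f x₀ + ε ≤ f x := by
  obtain hne | hne := (K \ ball x₀ δ).eq_empty_or_nonempty
  · exact ⟨1, one_pos, fun x hx hxb => absurd (hne ▸ ⟨hx, hxb⟩ : x ∈ (∅ : Set X)) (by simp)⟩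
  · obtain ⟨z, hz, hzmin⟩ :=
      (hK.diff isOpen_ball).exists_isMinOn hne (hf.mono Set.sdiff_subset)
    have hz₀ : z ≠ x₀ := by
      rintro rfl
      exact hz.2 (mem_ball_self hδ)
    refine ⟨f z - f x₀, sub_pos.2 (hmin z hz.1 hz₀), fun x hx hxb => ?_⟩
    have : f z ≤ f x := hzmin ⟨hx, hxb⟩
    linarith

/-- On a compact set, convergence to zero of the supremum distance of continuous functions bounds
their pointwise distance eventually uniformly. -/
theorem eventually_forall_abs_sub_lt_of_tendsto_iSup {X ι : Type*} [TopologicalSpace X]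
    {K : Set X} (hK : IsCompact K) {l : Filter ι} {F : ι → X → ℝ} {f : X → ℝ}
    (hF : ∀ i, ContinuousOn (F i) K) (hf : ContinuousOn f K)
    (h : Filter.Tendsto (fun i => ⨆ x : K, |F i x - f x|) l (nhds 0)) {ε : ℝ} (hε : 0 < ε) :
    ∀ᶠ i in l, ∀ x ∈ K, |F i x - f x| < ε := by
  filter_upwards [h.eventually_lt_const hε] with i hi x hx
  have hbdd : BddAbove (Set.range fun x : K => |F i x - f x|) := by
    have := hK.bddAbove_image ((hF i).sub hf).abs
    rwa [Set.image_eq_range] at this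
  exact (le_ciSup hbdd ⟨x, hx⟩).trans_lt hi

/-- Analytic content of Corollary 1: if continuous functions `f_n` converge uniformly on a
compact `K` to a continuous `f` with a unique global minimizer `θ₀` in the interior of `K`,
and the `f_n` are eventually uniformly strongly convex on a closed ball around `θ₀` contained
in `K`, then eventually `f_n` attains its global minimum over `K` at a unique point, which
lies in that closed ball. -/
theorem adavol_cor1_unique_minimizer
    {d : ℕ} (K : Set (EuclideanSpace ℝ (Fin d))) (hK : IsCompact K)
    (θ₀ : EuclideanSpace ℝ (Fin d)) (hθ₀ : θ₀ ∈ interior K)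
    (f : EuclideanSpace ℝ (Fin d) → ℝ) (hf_cont : ContinuousOn f K)
    (hf_min : ∀ θ ∈ K, θ ≠ θ₀ → f θ₀ < f θ)
    (fn : ℕ → EuclideanSpace ℝ (Fin d) → ℝ)
    (hfn_cont : ∀ n, ContinuousOn (fn n) K)
    (h_unif : Filter.Tendsto (fun n => ⨆ θ : K, |fn n θ - f θ|)
      Filter.atTop (nhds 0))
    (δ : ℝ) (hδ : 0 < δ) (hball : closedBall θ₀ δ ⊆ K)
    (C : ℝ) (hC : 0 < C) (N₀ : ℕ)
    (h_smooth : ∀ n ≥ N₀, ContDiffOn ℝ 2 (fn n) (closedBall θ₀ δ))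
    (h_convex : ∀ n ≥ N₀, ∀ θ ∈ closedBall θ₀ δ,
      ∀ g : EuclideanSpace ℝ (Fin d),
        C * ‖g‖ ^ 2 ≤ fderiv ℝ (fderiv ℝ (fn n)) θ g g) :
    ∃ N : ℕ, ∀ n ≥ N, ∃ θm ∈ closedBall θ₀ δ,
      (∀ θ ∈ K, fn n θm ≤ fn n θ) ∧
      ∀ θ' ∈ K, (∀ θ ∈ K, fn n θ' ≤ fn n θ) → θ' = θm := by
  obtain ⟨ε, hε, hgap⟩ := exists_pos_forall_add_le_of_isCompact hK hf_cont hf_min hδ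
  obtain ⟨N, hN⟩ := Filter.eventually_atTop.1
    (eventually_forall_abs_sub_lt_of_tendsto_iSup hK hfn_cont hf_cont h_unif (half_pos hε))
  refine ⟨max N N₀, fun n hn => ?_⟩
  have hclose := hN n (le_of_max_le_left hn)
  have hn₀ : n ≥ N₀ := le_of_max_le_right hn
  have hθ₀K : θ₀ ∈ K := interior_subset hθ₀
  have hloc : ∀ x ∈ K, (∀ θ ∈ K, fn n x ≤ fn n θ) → x ∈ ball θ₀ δ := by
    intro x hx hxmin
    by_contra hxb
    have := hgap x hx hxb
    have := hxmin θ₀ hθ₀K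
    have := abs_lt.1 (hclose x hx)
    have := abs_lt.1 (hclose θ₀ hθ₀K)
    linarith
  have hcrit : ∀ x ∈ K, (∀ θ ∈ K, fn n x ≤ fn n θ) → fderiv ℝ (fn n) x = 0 := by
    intro x hx hxmin
    have hKx : K ∈ nhds x := Filter.mem_of_superset
      (isOpen_ball.mem_nhds (hloc x hx hxmin)) (ball_subset_closedBall.trans hball)
    exact IsLocalMin.fderiv_eq_zero (Filter.mem_of_superset hKx hxmin)
  obtain ⟨θm, hθm, hmin⟩ := hK.exists_isMinOn ⟨θ₀, hθ₀K⟩ (hfn_cont n)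
  refine ⟨θm, ball_subset_closedBall (hloc θm hθm hmin), hmin, fun θ' hθ' hmin' => ?_⟩
  refine eq_of_fderiv_eq_zero_of_hessian_pos isOpen_ball (convex_ball θ₀ δ)
    ((h_smooth n hn₀).mono ball_subset_closedBall) (fun z hz v hv => ?_)
    (hloc θ' hθ' hmin') (hloc θm hθm hmin) (hcrit θ' hθ' hmin') (hcrit θm hθm hmin)
  have := norm_pos_iff.2 hv
  exact lt_of_lt_of_le (by positivity) (h_convex n hn₀ z (ball_subset_closedBall hz) v)
end

section
/- Fix x, y ∈ ℝ and let s > 0. The 2×2 matrix ((2y² − s)/(2s³)) · [[1, x²], [x², x⁴]] is positive semidefinite if and only if 2y² ≥ s. In particular, the Hessian of the ARCH(1) quasi-likelihood loss l(ω, α) = (1/2)(y²/s + log s) with s = ω + αx² > 0 is positive semidefinite at (ω, α) if and only if 2y² ≥ ω + αx². -/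
open Matrix

open Topology in
/-- The second derivative of a function of one variable composed with a linear functional. -/
theorem fderiv_fderiv_comp_clm_apply {E : Type*} [NormedAddCommGroup E] [NormedSpace ℝ E]
    {g g' : ℝ → ℝ} {c : ℝ} (L : E →L[ℝ] ℝ) (p u v : E)
    (hg : ∀ᶠ t in 𝓝 (L p), HasDerivAt g (g' t) t) (hg' : HasDerivAt g' c (L p)) :
    fderiv ℝ (fderiv ℝ fun q => g (L q)) p u v = c * L u * L v := by
  have h : fderiv ℝ (fun q => g (L q)) =ᶠ[𝓝 p] fun q => g' (L q) • L := by
    filter_upwards [L.continuous.continuousAt.eventually hg] with q hq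
    exact (hq.comp_hasFDerivAt q L.hasFDerivAt).fderiv
  have h' : HasFDerivAt (fun q => g' (L q) • L) ((c • L).smulRight L) p :=
    (hg'.comp_hasFDerivAt p L.hasFDerivAt).smul_const L
  rw [h.fderiv_eq, h'.fderiv]
  simp

theorem hasDerivAt_quasiLikelihood (y : ℝ) {t : ℝ} (ht : t ≠ 0) :
    HasDerivAt (fun t => (1 / 2) * (y ^ 2 / t + Real.log t))
      ((1 / 2) * (-y ^ 2 / t ^ 2 + t⁻¹)) t := by
  have h := (((hasDerivAt_const t (y ^ 2)).fun_div (hasDerivAt_id' t) ht).fun_add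
    (Real.hasDerivAt_log ht)).const_mul (1 / 2)
  exact h.congr_deriv (by ring)

theorem hasDerivAt_deriv_quasiLikelihood (y : ℝ) {t : ℝ} (ht : t ≠ 0) :
    HasDerivAt (fun t => (1 / 2) * (-y ^ 2 / t ^ 2 + t⁻¹))
      ((2 * y ^ 2 - t) / (2 * t ^ 3)) t := by
  have h := (((hasDerivAt_const t (-y ^ 2)).fun_div (hasDerivAt_pow 2 t)
    (pow_ne_zero 2 ht)).fun_add (hasDerivAt_inv ht)).const_mul (1 / 2)
  refine h.congr_deriv ?_
  field_simp
  ring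

/-- A multiple of the outer square of `(1, a)` is positive semidefinite iff the factor is
nonnegative. -/
theorem posSemidef_smul_outer_square_iff (c a : ℝ) :
    (c • !![(1 : ℝ), a; a, a ^ 2]).PosSemidef ↔ 0 ≤ c := by
  refine ⟨fun h => by simpa using h.diag_nonneg (i := 0), fun hc => ?_⟩
  have h : !![(1 : ℝ), a; a, a ^ 2] = vecMulVec ![1, a] (star ![1, a]) := by
    ext i j
    fin_cases i <;> fin_cases j <;> simp [vecMulVec_apply, sq]
  rw [h]
  exact (posSemidef_vecMulVec_self_star _).smul hc

/-- For `s > 0`, the matrix `((2y² − s)/(2s³)) · [[1, x²], [x², x⁴]]` is positive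
semidefinite iff `2y² ≥ s`; in particular, the Hessian of the ARCH(1) quasi-likelihood loss
`l(ω, α) = (1/2)(y²/s + log s)` with `s = ω + αx² > 0` is positive semidefinite at `(ω, α)`
iff `2y² ≥ ω + αx²`. -/
theorem adavol_arch1_psd_criterion
    (x y s : ℝ) (hs : 0 < s) :
    ((((2 * y ^ 2 - s) / (2 * s ^ 3)) •
        !![(1 : ℝ), x ^ 2; x ^ 2, x ^ 4]).PosSemidef ↔ 2 * y ^ 2 ≥ s) ∧
    ∀ ω α : ℝ, ω + α * x ^ 2 = s →
      ((∀ u : ℝ × ℝ, 0 ≤ fderiv ℝ (fderiv ℝ (fun p : ℝ × ℝ =>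
          (1 / 2) * (y ^ 2 / (p.1 + p.2 * x ^ 2) + Real.log (p.1 + p.2 * x ^ 2))))
            (ω, α) u u)
        ↔ 2 * y ^ 2 ≥ s) := by
  have hc : 0 ≤ (2 * y ^ 2 - s) / (2 * s ^ 3) ↔ 2 * y ^ 2 ≥ s := by
    rw [le_div_iff₀ (by positivity), zero_mul, sub_nonneg]
  refine ⟨?_, fun ω α h => ?_⟩
  · rw [← hc, ← posSemidef_smul_outer_square_iff _ (x ^ 2), ← pow_mul]
  · let L : ℝ × ℝ →L[ℝ] ℝ :=
      ContinuousLinearMap.fst ℝ ℝ ℝ + x ^ 2 • ContinuousLinearMap.snd ℝ ℝ ℝ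
    have hL (p : ℝ × ℝ) : p.1 + p.2 * x ^ 2 = L p := by simp [L, mul_comm]
    have hp : L (ω, α) = s := by rw [← hL, h]
    have hp0 : L (ω, α) ≠ 0 := hp ▸ hs.ne'
    simp only [hL]
    rw [← hc]
    have key (u : ℝ × ℝ) := fderiv_fderiv_comp_clm_apply L (ω, α) u u
      ((eventually_ne_nhds hp0).mono fun t ht => hasDerivAt_quasiLikelihood y ht)
      (hasDerivAt_deriv_quasiLikelihood y hp0)
    simp only [key, hp, mul_assoc]
    exact ⟨fun H => by simpa [L] using H (1, 0), fun H u => mul_nonneg H (mul_self_nonneg _)⟩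
end
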